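/- Let g : ℝ → ℂ be a continuous 2π-periodic function with Fourier coefficients ĝ(k) = (1/2π) ∫₀^{2π} g(x) e^{−ikx} dx satisfying Σ_{k∈ℤ} |ĝ(k)| < ∞ and g(x) = Σ_{k∈ℤ} ĝ(k) e^{ikx} for all x. Suppose there exist C ≥ 0 and β > 0 with |ĝ(k)| ≤ C e^{−β|k|} for all k ∈ ℤ. Then for every positive integer N, |(1/N) Σ_{j=0}^{N−1} g(2πj/N) − ĝ(0)| ≤ 2C e^{−βN} / (1 − e^{−βN}). -/

import Mathlib

open Real

/-- Discrete orthogonality: the average of `e^{ikx}` over the `N` equispaced nodes of `[0, 2π)`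
is `1` if `N ∣ k` and `0` otherwise. -/
theorem average_exp_equispaced (N : ℕ) (hN : 0 < N) (k : ℤ) :
    (1 / (N : ℂ)) * ∑ j ∈ Finset.range N,
        Complex.exp (Complex.I * (k : ℂ) * ((2 * π * j / N : ℝ) : ℂ))
      = if (N : ℤ) ∣ k then 1 else 0 := by
  have hN' : (N : ℂ) ≠ 0 := by exact_mod_cast hN.ne'
  have hprim := Complex.isPrimitiveRoot_exp N hN.ne'
  set ζ := Complex.exp (2 * π * Complex.I / N) with hζ
  have hterm : ∀ j : ℕ, Complex.exp (Complex.I * (k : ℂ) * ((2 * π * j / N : ℝ) : ℂ))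
      = (ζ ^ k) ^ j := by
    intro j
    rw [hζ, ← Complex.exp_int_mul, ← Complex.exp_nat_mul]
    congr 1
    push_cast
    ring
  simp_rw [hterm]
  split_ifs with h
  · rw [(hprim.zpow_eq_one_iff_dvd k).2 h]
    simp [hN']
  · have hne : ζ ^ k ≠ 1 := fun h1 => h ((hprim.zpow_eq_one_iff_dvd k).1 h1)
    have hpow : (ζ ^ k) ^ N = 1 := by
      rw [← zpow_natCast, zpow_comm, zpow_natCast, hprim.pow_eq_one, one_zpow]
    rw [geom_sum_eq hne, hpow, sub_self, zero_div, mul_zero]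

/-- Aliasing formula: the equispaced average of an absolutely convergent Fourier series is the sum
of the coefficients whose index is a multiple of `N`. -/
theorem hasSum_aliasing {g : ℝ → ℂ} {c : ℤ → ℂ} (hsum : Summable fun k : ℤ => ‖c k‖)
    (hrep : ∀ x : ℝ, g x = ∑' k : ℤ, c k * Complex.exp (Complex.I * (k : ℂ) * (x : ℂ)))
    (N : ℕ) (hN : 0 < N) :
    HasSum (fun m : ℤ => c (N * m))
      ((1 / (N : ℂ)) * ∑ j ∈ Finset.range N, g (2 * π * j / N)) := by
  have hg : ∀ x : ℝ,
      HasSum (fun k : ℤ => c k * Complex.exp (Complex.I * (k : ℂ) * (x : ℂ))) (g x) := by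
    intro x
    rw [hrep x]
    refine (Summable.of_norm_bounded hsum fun k => le_of_eq ?_).hasSum
    have h : Complex.I * (k : ℂ) * (x : ℂ) = ((k * x : ℝ) : ℂ) * Complex.I := by
      push_cast
      ring
    rw [norm_mul, h, Complex.norm_exp_ofReal_mul_I, mul_one]
  have hall := (hasSum_sum fun (j : ℕ) (_ : j ∈ Finset.range N) =>
    hg (2 * π * j / N)).mul_left (1 / (N : ℂ))
  have hmul : Function.Injective fun m : ℤ => (N : ℤ) * m :=
    mul_right_injective₀ (by exact_mod_cast hN.ne')
  have hdvd : HasSum (fun k : ℤ => if (N : ℤ) ∣ k then c k else 0)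
      ((1 / (N : ℂ)) * ∑ j ∈ Finset.range N, g (2 * π * j / N)) := by
    refine hall.congr_fun fun k => ?_
    rw [← Finset.mul_sum, mul_left_comm, average_exp_equispaced N hN k]
    simp
  rw [← hmul.hasSum_iff] at hdvd
  · simpa [Function.comp_def] using hdvd
  · intro k hk
    exact if_neg fun ⟨m, hm⟩ => hk ⟨m, hm.symm⟩

/-- The two-sided geometric series with its central term removed. -/
theorem hasSum_int_geometric_ne_zero {r : ℝ} (hr₀ : 0 ≤ r) (hr₁ : r < 1) (C : ℝ) :
    HasSum (fun m : ℤ => if m = 0 then 0 else C * r ^ m.natAbs) (2 * C * r / (1 - r)) := by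
  have hgeom : HasSum (fun n : ℕ => C * r ^ (n + 1)) (C * r / (1 - r)) := by
    have h := (hasSum_geometric_of_lt_one hr₀ hr₁).mul_left (C * r)
    rw [← div_eq_mul_inv] at h
    exact h.congr_fun fun n => by ring
  have h := HasSum.of_add_one_of_neg_add_one
    (f := fun m : ℤ => if m = 0 then 0 else C * r ^ m.natAbs)
    (hgeom.congr_fun fun n => by
      rw [if_neg (by omega), show ((n : ℤ) + 1).natAbs = n + 1 by omega])
    (hgeom.congr_fun fun n => by
      rw [if_neg (by omega), show (-((n : ℤ) + 1)).natAbs = n + 1 by omega])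
  convert h using 1
  simp only [if_true]
  ring

/-- Exponential accuracy of the trapezoidal rule: for a continuous `2π`-periodic
function `g` with absolutely summable, geometrically decaying Fourier
coefficients `ĝ`, the equispaced average of `g` approximates the mean `ĝ(0)`
with error at most `2C e^{−βN} / (1 − e^{−βN})`. -/
theorem trapezoidal_exponential_convergence
    (g : ℝ → ℂ) (hg : Continuous g) (hper : Function.Periodic g (2 * π))
    (ghat : ℤ → ℂ)
    (hghat : ∀ k : ℤ, ghat k
        = (1 / (2 * (π : ℂ))) *
            ∫ x in (0 : ℝ)..(2 * π), g x * Complex.exp (-Complex.I * (k : ℂ) * (x : ℂ)))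
    (hsum : Summable fun k : ℤ => ‖ghat k‖)
    (hrep : ∀ x : ℝ, g x = ∑' k : ℤ, ghat k * Complex.exp (Complex.I * (k : ℂ) * (x : ℂ)))
    (C β : ℝ) (hC : 0 ≤ C) (hβ : 0 < β)
    (hdecay : ∀ k : ℤ, ‖ghat k‖ ≤ C * Real.exp (-β * |(k : ℝ)|)) :
    ∀ N : ℕ, 0 < N →
      ‖(1 / (N : ℂ)) * (∑ j ∈ Finset.range N, g (2 * π * j / N)) - ghat 0‖
        ≤ 2 * C * Real.exp (-β * N) / (1 - Real.exp (-β * N)) := by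
  intro N hN
  have hNβ : 0 < β * N := mul_pos hβ (by exact_mod_cast hN)
  have hr₁ : Real.exp (-β * N) < 1 := by
    rw [Real.exp_lt_one_iff]
    linarith
  have hdiff : HasSum (fun m : ℤ => if m = 0 then 0 else ghat (N * m))
      ((1 / (N : ℂ)) * (∑ j ∈ Finset.range N, g (2 * π * j / N)) - ghat 0) := by
    refine ((hasSum_aliasing hsum hrep N hN).sub (hasSum_ite_eq 0 (ghat 0))).congr_fun fun m => ?_
    by_cases hm : m = 0 <;> simp [hm]
  have hgeom := hasSum_int_geometric_ne_zero (Real.exp_pos _).le hr₁ C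
  refine hdiff.norm_le_of_bounded hgeom fun m => ?_
  split_ifs with hm
  · simp
  · refine (hdecay _).trans_eq ?_
    rw [← Real.exp_nat_mul]
    congr 2
    push_cast [abs_mul, Nat.cast_natAbs, Nat.abs_cast]
    ring
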